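/- Wegner estimate for exponentially decaying sign-indefinite single-site potentials (Theorem 2.6): Consider the discrete alloy-type model and assume: ν has a probability density ρ of finite total variation; there are constants C, α > 0 with |u(k)| ≤ C e^{−α|k|₁} for all k ∈ ℤ^d; and there exist a multi-index I₀ ∈ ℕ₀^d and a real number c_u ≠ 0 such that D^J G(0) = 0 for every J ∈ ℕ₀^d with J ≤ I₀ and J ≠ I₀, and D^{I₀} G(0) = c_u. Then there exists a constant C(u) > 0, depending only on d and u, such that for every l ∈ ℕ and every bounded interval I ⊂ ℝ: 𝔼( Tr χ_I(H_{Λ_l}) ) ≤ λ^{−1} C(u) ‖ρ‖_Var |I| (2l+1)^{2d+|I₀|}. -/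

import Mathlib

open MeasureTheory
open scoped ENNReal

noncomputable section

/-- The cube `Λ_{L,k} = {x ∈ ℤ^d : |x-k|_∞ ≤ L}` as a finite set. -/
def cube {d : ℕ} (L : ℕ) (k : Fin d → ℤ) : Finset (Fin d → ℤ) :=
  Fintype.piFinset fun i => Finset.Icc (k i - L) (k i + L)

/-- The `ℓ¹` distance on `ℤ^d`. -/
def dist1 {d : ℕ} (x y : Fin d → ℤ) : ℕ := ∑ i, (x i - y i).natAbs

/-- The alloy-type random potential `V_ω(x) = ∑_{k∈ℤ^d} ω_k u(x-k)`. -/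
def potential {d : ℕ} (u ω : (Fin d → ℤ) → ℝ) (x : Fin d → ℤ) : ℝ :=
  ∑' k : Fin d → ℤ, ω k * u (x - k)

/-- The finite-volume discrete alloy-type Hamiltonian `H_Λ = -Δ_Λ + λ V_Λ`. -/
def hamiltonian {d : ℕ} (lam : ℝ) (u ω : (Fin d → ℤ) → ℝ)
    (Λ : Finset (Fin d → ℤ)) : Matrix Λ Λ ℝ :=
  Matrix.of fun x y =>
    if dist1 (x : Fin d → ℤ) (y : Fin d → ℤ) = 1 then -1
    else if x = y then lam * potential u ω (x : Fin d → ℤ)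
    else 0

/-- The finite-volume Green function `G_Λ(z) = (H_Λ - z)⁻¹` at complex energy `z`. -/
def green {d : ℕ} (lam : ℝ) (u ω : (Fin d → ℤ) → ℝ) (Λ : Finset (Fin d → ℤ))
    (z : ℂ) : Matrix Λ Λ ℂ :=
  ((hamiltonian lam u ω Λ).map (fun a => (a : ℂ)) - z • (1 : Matrix Λ Λ ℂ))⁻¹

/-- `Tr χ_I(H)`: the number of eigenvalues (with multiplicity) of the real symmetric matrix `H`
lying in the set `I`. -/
def eigCount {m : Type*} [Fintype m] [DecidableEq m] (H : Matrix m m ℝ) (I : Set ℝ) : ℕ :=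
  if hH : H.IsHermitian then Nat.card {i // hH.eigenvalues i ∈ I} else 0

/-- `P` is the product measure `⊗_{k∈ℤ^d} ν`, characterized on finite cylinder sets. -/
def IsProductOf {d : ℕ} (P : Measure ((Fin d → ℤ) → ℝ)) (ν : Measure ℝ) : Prop :=
  ∀ (S : Finset (Fin d → ℤ)) (B : (Fin d → ℤ) → Set ℝ),
    (∀ k ∈ S, MeasurableSet (B k)) →
      P {ω | ∀ k ∈ S, ω k ∈ B k} = ∏ k ∈ S, ν (B k)

/-- The set of values `∫ f v'` over test functions `v ∈ C_c^∞(ℝ)` with `|v| ≤ 1`. -/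
def varSet (f : ℝ → ℝ) : Set ℝ :=
  (fun v : ℝ → ℝ => ∫ x, f x * deriv v x) ''
    {v | ContDiff ℝ (⊤ : ℕ∞) v ∧ HasCompactSupport v ∧ ∀ x, |v x| ≤ 1}

/-- The total variation norm `‖f‖_Var = sup {∫ f v' : v ∈ C_c^∞(ℝ), |v| ≤ 1}`. -/
def varNorm (f : ℝ → ℝ) : ℝ := sSup (varSet f)

/-- The partial derivative of `f : ℝ^d → ℝ` in the `i`-th coordinate direction. -/
def pderiv' {d : ℕ} (i : Fin d) (f : (Fin d → ℝ) → ℝ) : (Fin d → ℝ) → ℝ :=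
  fun x => deriv (fun τ : ℝ => f (Function.update x i τ)) (x i)

/-- The `n`-fold iterated partial derivative in the `i`-th coordinate direction. -/
def iterPDeriv {d : ℕ} (i : Fin d) : ℕ → ((Fin d → ℝ) → ℝ) → ((Fin d → ℝ) → ℝ)
  | 0, f => f
  | n + 1, f => pderiv' i (iterPDeriv i n f)

/-- The mixed partial derivative `D^J f = ∂^{j₁}_{s₁} ⋯ ∂^{j_d}_{s_d} f`. -/
def mpderiv {d : ℕ} (J : Fin d → ℕ) (f : (Fin d → ℝ) → ℝ) : (Fin d → ℝ) → ℝ :=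
  (List.finRange d).foldr (fun i g => iterPDeriv i (J i) g) f

/-- The generating function `G(s) = ∑_{k∈ℤ^d} u(-k) e^{⟨k,s⟩}`. -/
def Gfun {d : ℕ} (u : (Fin d → ℤ) → ℝ) (s : Fin d → ℝ) : ℝ :=
  ∑' k : Fin d → ℤ, u (-k) * Real.exp (∑ r, (k r : ℝ) * s r)

section Inertia

open scoped Matrix

variable {m : Type*} [Fintype m]

/-- A matrix has this property when its quadratic form is strictly below `E` times the Euclidean
form on some `j`-dimensional subspace. -/
def HasQuadBelow (A : Matrix m m ℝ) (E : ℝ) (j : ℕ) : Prop :=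
  ∃ f : (Fin j → ℝ) →ₗ[ℝ] (m → ℝ), ∀ x, x ≠ 0 → f x ⬝ᵥ A *ᵥ f x < E * (f x ⬝ᵥ f x)

theorem isOpen_setOf_hasQuadBelow (E : ℝ) (j : ℕ) :
    IsOpen {A : m → m → ℝ | HasQuadBelow (Matrix.of A) E j} := by
  simp only [HasQuadBelow, Set.ofPred_exists]
  refine isOpen_iUnion fun f => ?_
  have hsphere : {A : m → m → ℝ | ∀ x, x ≠ 0 →
      f x ⬝ᵥ Matrix.of A *ᵥ f x < E * (f x ⬝ᵥ f x)} =
      {A | ∀ x ∈ Metric.sphere (0 : Fin j → ℝ) 1,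
        f x ⬝ᵥ Matrix.of A *ᵥ f x < E * (f x ⬝ᵥ f x)} := by
    ext A
    refine ⟨fun h x hx => h x (Metric.ne_of_mem_sphere hx one_ne_zero), fun h x hx => ?_⟩
    have hn : 0 < ‖x‖ := norm_pos_iff.mpr hx
    have := h (‖x‖⁻¹ • x) (by simp [norm_smul, hn.ne'])
    simp only [map_smul, Matrix.mulVec_smul, dotProduct_smul, smul_dotProduct, smul_eq_mul] at this
    have h2 : 0 < ‖x‖⁻¹ * ‖x‖⁻¹ := by positivity
    refine lt_of_mul_lt_mul_left ?_ h2.le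
    calc _ = ‖x‖⁻¹ * (‖x‖⁻¹ * f x ⬝ᵥ Matrix.of A *ᵥ f x) := by ring
      _ < _ := this
      _ = _ := by ring
  rw [hsphere, isOpen_iff_eventually]
  intro A hA
  refine (isCompact_sphere (0 : Fin j → ℝ) 1).eventually_forall_of_forall_eventually
    fun x hx => ?_
  have hf : Continuous f := f.continuous_of_finiteDimensional
  refine IsOpen.mem_nhds (s := {p : (m → m → ℝ) × (Fin j → ℝ) |
    f p.2 ⬝ᵥ Matrix.of p.1 *ᵥ f p.2 < E * (f p.2 ⬝ᵥ f p.2)}) ?_ (hA x hx)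
  simp only [dotProduct, Matrix.mulVec, Matrix.of_apply]
  refine isOpen_lt ?_ ?_ <;> fun_prop

variable [DecidableEq m]

theorem Matrix.IsHermitian.exists_diagonalizing_equiv {A : Matrix m m ℝ} (hA : A.IsHermitian) :
    ∃ e : (m → ℝ) ≃ₗ[ℝ] (m → ℝ), ∀ y,
      y ⬝ᵥ A *ᵥ y = ∑ i, hA.eigenvalues i * (e y i) ^ 2 ∧ y ⬝ᵥ y = ∑ i, (e y i) ^ 2 := by
  set U : Matrix m m ℝ := (hA.eigenvectorUnitary : Matrix m m ℝ) with hU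
  have h1 : U * Uᵀ = 1 := by
    have := Unitary.coe_mul_star_self hA.eigenvectorUnitary
    simpa [Matrix.star_eq_conjTranspose] using this
  have h2 : Uᵀ * U = 1 := mul_eq_one_comm.mp h1
  have hs : A = U * Matrix.diagonal hA.eigenvalues * Uᵀ := by
    have := hA.spectral_theorem
    rw [Unitary.conjStarAlgAut_apply] at this
    simpa [Matrix.star_eq_conjTranspose, Function.comp_def] using this
  refine ⟨Matrix.toLin'OfInv h1 h2, fun y => ⟨?_, ?_⟩⟩
  · have : y ⬝ᵥ A *ᵥ y = (Uᵀ *ᵥ y) ⬝ᵥ (Matrix.diagonal hA.eigenvalues *ᵥ (Uᵀ *ᵥ y)) := by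
      conv_lhs => rw [hs]
      rw [← Matrix.mulVec_mulVec, ← Matrix.mulVec_mulVec, Matrix.dotProduct_mulVec,
        ← Matrix.mulVec_transpose]
    rw [this]
    simp only [dotProduct, Matrix.mulVec_diagonal]
    refine Finset.sum_congr rfl fun i _ => ?_
    simp [Matrix.toLin'OfInv]
    ring
  · have : y ⬝ᵥ y = (Uᵀ *ᵥ y) ⬝ᵥ (Uᵀ *ᵥ y) := by
      conv_rhs => rw [Matrix.dotProduct_mulVec, Matrix.vecMul_transpose, Matrix.mulVec_mulVec, h1,
        Matrix.one_mulVec]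
    rw [this]
    simp only [dotProduct]
    refine Finset.sum_congr rfl fun i _ => ?_
    simp [Matrix.toLin'OfInv]
    ring

theorem le_eigCount_Iio_iff {A : Matrix m m ℝ} (hA : A.IsHermitian) (E : ℝ) (j : ℕ) :
    j ≤ eigCount A (Set.Iio E) ↔ HasQuadBelow A E j := by
  obtain ⟨e, he⟩ := hA.exists_diagonalizing_equiv
  classical
  rw [eigCount, dif_pos hA, Nat.card_eq_fintype_card]
  constructor
  · intro hj
    obtain ⟨g⟩ : Nonempty (Fin j ↪ {i // hA.eigenvalues i ∈ Set.Iio E}) :=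
      Function.Embedding.nonempty_of_card_le (by simpa using hj)
    have hinj : Function.Injective fun i => (g i : m) :=
      Subtype.val_injective.comp g.injective
    refine ⟨e.symm.toLinearMap ∘ₗ
      Function.ExtendByZero.linearMap ℝ (fun i => (g i : m)), fun x hx => ?_⟩
    obtain ⟨hq, hn⟩ := he ((e.symm.toLinearMap ∘ₗ
      Function.ExtendByZero.linearMap ℝ (fun i => (g i : m))) x)
    rw [hq, hn, Finset.mul_sum]
    simp only [LinearMap.comp_apply, LinearEquiv.coe_coe, LinearEquiv.apply_symm_apply,
      Function.ExtendByZero.linearMap_apply]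
    obtain ⟨i₀, hi₀⟩ := Function.ne_iff.mp hx
    refine Finset.sum_lt_sum (fun i _ => ?_) ⟨g i₀, Finset.mem_univ _, ?_⟩
    · by_cases h : ∃ k, (g k : m) = i
      · obtain ⟨k, rfl⟩ := h
        have := (g k).2
        exact mul_le_mul_of_nonneg_right (le_of_lt this) (sq_nonneg _)
      · rw [Function.extend_apply' _ _ _ h]
        simp
    · rw [hinj.extend_apply]
      have h1 : hA.eigenvalues (g i₀) < E := (g i₀).2
      have h2 : 0 < x i₀ ^ 2 := by
        have : x i₀ ≠ 0 := hi₀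
        positivity
      exact mul_lt_mul_of_pos_right h1 h2
  · rintro ⟨f, hf⟩
    by_contra! hlt
    set L : (Fin j → ℝ) →ₗ[ℝ] ({i // hA.eigenvalues i ∈ Set.Iio E} → ℝ) :=
      (LinearMap.funLeft ℝ ℝ Subtype.val) ∘ₗ e.toLinearMap ∘ₗ f with hL
    have hker : LinearMap.ker L ≠ ⊥ := by
      apply LinearMap.ker_ne_bot_of_finrank_lt
      simpa using hlt
    obtain ⟨x, hx, hx0⟩ := (Submodule.ne_bot_iff _).mp hker
    refine absurd (hf x hx0) (not_lt.mpr ?_)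
    obtain ⟨hq, hn⟩ := he (f x)
    rw [hq, hn, Finset.mul_sum]
    refine Finset.sum_le_sum fun i _ => ?_
    by_cases hi : hA.eigenvalues i ∈ Set.Iio E
    · have : e (f x) i = 0 := by
        have := congrFun (LinearMap.mem_ker.mp hx) ⟨i, hi⟩
        simpa [hL, LinearMap.funLeft] using this
      simp [this]
    · exact mul_le_mul_of_nonneg_right (not_lt.mp hi) (sq_nonneg _)

theorem eigCount_Iio_le_of_form_le {A B : Matrix m m ℝ} (hA : A.IsHermitian) (hB : B.IsHermitian)
    {E F : ℝ} (h : ∀ y, y ⬝ᵥ A *ᵥ y + (F - E) * (y ⬝ᵥ y) ≤ y ⬝ᵥ B *ᵥ y) :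
    eigCount B (Set.Iio F) ≤ eigCount A (Set.Iio E) := by
  obtain ⟨f, hf⟩ := (le_eigCount_Iio_iff hB F _).mp le_rfl
  refine (le_eigCount_Iio_iff hA E _).mpr ⟨f, fun x hx => ?_⟩
  linarith [h (f x), hf x hx]

theorem eigCount_le_card (A : Matrix m m ℝ) (I : Set ℝ) : eigCount A I ≤ Fintype.card m := by
  classical
  unfold eigCount
  split_ifs with hA
  · rw [Nat.card_eq_fintype_card]
    exact Fintype.card_subtype_le _
  · exact Nat.zero_le _

theorem eigCount_Icc_add_Iio_le (A : Matrix m m ℝ) {E F G : ℝ} (hEF : E ≤ F) (hFG : F < G) :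
    eigCount A (Set.Icc E F) + eigCount A (Set.Iio E) ≤ eigCount A (Set.Iio G) := by
  classical
  unfold eigCount
  split_ifs with hA
  · simp only [Nat.card_eq_fintype_card, Fintype.card_subtype]
    rw [← Finset.card_union_of_disjoint]
    · refine Finset.card_le_card fun i => ?_
      simp only [Finset.mem_union, Finset.mem_filter, Finset.mem_univ, true_and, Set.mem_Icc,
        Set.mem_Iio]
      rintro (h | h) <;> linarith [h]
    · rw [Finset.disjoint_left]
      intro i
      simp only [Finset.mem_filter, Finset.mem_univ, true_and, Set.mem_Icc, Set.mem_Iio]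
      intro h
      linarith
  · simp

theorem measurable_eigCount_Iio {Ω : Type*} [MeasurableSpace Ω] {A : Ω → Matrix m m ℝ}
    (hA : ∀ ω, (A ω).IsHermitian) (hm : ∀ i j, Measurable fun ω => A ω i j) (E : ℝ) :
    Measurable fun ω => eigCount (A ω) (Set.Iio E) := by
  refine measurable_of_Ici fun j => ?_
  have : (fun ω => eigCount (A ω) (Set.Iio E)) ⁻¹' Set.Ici j =
      (fun ω => (fun i k => A ω i k : m → m → ℝ)) ⁻¹'
        {B : m → m → ℝ | HasQuadBelow (Matrix.of B) E j} := by
    ext ω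
    exact le_eigCount_Iio_iff (hA ω) E j
  rw [this]
  exact measurableSet_preimage (by fun_prop) (isOpen_setOf_hasQuadBelow E j).measurableSet

end Inertia
section TotalVariation

theorem integral_abs_le_of_forall_contDiff {g : ℝ → ℝ} (hg : Integrable g) {c : ℝ}
    (h : ∀ φ : ℝ → ℝ, ContDiff ℝ (⊤ : ℕ∞) φ → HasCompactSupport φ → (∀ x, |φ x| ≤ 1) →
      ∫ x, g x * φ x ≤ c) :
    ∫ x, |g x| ≤ c := by
  wlog hgm : Measurable g generalizing g
  · have hae := hg.1.ae_eq_mk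
    have h1 : ∫ x, |g x| = ∫ x, |hg.1.mk g x| :=
      integral_congr_ae (hae.mono fun x hx => by simp only [hx])
    rw [h1]
    refine this (hg.congr hae) (fun φ h1 h2 h3 => ?_) hg.1.stronglyMeasurable_mk.measurable
    refine le_trans (le_of_eq ?_) (h φ h1 h2 h3)
    exact integral_congr_ae (hae.mono fun x hx => by simp only [hx])
  refine le_of_forall_pos_le_add fun ε hε => ?_
  set μ : Measure ℝ := volume.withDensity fun x => ‖g x‖ₑ with hμ
  have : IsFiniteMeasure μ := isFiniteMeasure_withDensity hg.2.ne
  have key : ∀ A : Set ℝ, MeasurableSet A →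
      ∃ K ⊆ A, IsCompact K ∧ ∫ x in A \ K, |g x| ≤ ε / 4 := by
    intro A hA
    obtain ⟨K, hKA, hK, hlt⟩ := hA.exists_isCompact_sdiff_lt (μ := μ) (measure_ne_top _ _)
      (ε := ENNReal.ofReal (ε / 4)) (by simpa using hε)
    refine ⟨K, hKA, hK, ?_⟩
    rw [withDensity_apply _ (hA.diff hK.measurableSet)] at hlt
    have h2 := ofReal_integral_norm_eq_lintegral_enorm (hg.restrict (s := A \ K))
    rw [← h2, ENNReal.ofReal_lt_ofReal_iff (by linarith)] at hlt
    exact hlt.le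
  have hA : MeasurableSet {x | 0 ≤ g x} := measurableSet_le measurable_const hgm
  obtain ⟨K₁, hK₁s, hK₁, hi₁⟩ := key _ hA
  obtain ⟨K₂, hK₂s, hK₂, hi₂⟩ := key _ hA.compl
  obtain ⟨r, hr⟩ := (hK₁.union hK₂).isBounded.subset_ball 0
  have bump : ∀ K L : Set ℝ, IsCompact K → IsCompact L → Disjoint K L → K ⊆ Metric.ball 0 r →
      ∃ φ : ℝ → ℝ, ContDiff ℝ (⊤ : ℕ∞) φ ∧ HasCompactSupport φ ∧ (∀ x ∈ K, φ x = 1) ∧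
        (∀ x ∈ L, φ x = 0) ∧ ∀ x, φ x ∈ Set.Icc (0 : ℝ) 1 := by
    intro K L hK hL hd hKr
    obtain ⟨f, h0, h1, h2⟩ := exists_contMDiffMap_zero_one_of_isClosed (n := (⊤ : ℕ∞))
      (modelWithCornersSelf ℝ ℝ) (s := L ∪ (Metric.ball 0 r)ᶜ) (t := K)
      (hL.isClosed.union Metric.isOpen_ball.isClosed_compl) hK.isClosed
      (Set.disjoint_union_left.mpr
        ⟨hd.symm, Set.disjoint_left.mpr fun x hx hxK => hx (hKr hxK)⟩)
    refine ⟨f, f.contMDiff.contDiff, ?_, h1, fun x hx => h0 (Or.inl hx), h2⟩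
    refine HasCompactSupport.intro (isCompact_closedBall (0 : ℝ) r) fun x hx => ?_
    exact h0 (Or.inr fun hx' => hx (Metric.ball_subset_closedBall hx'))
  have hd : Disjoint K₁ K₂ := Set.disjoint_left.mpr fun x h1 h2 => hK₂s h2 (hK₁s h1)
  obtain ⟨φ₁, hφ₁, hc₁, h11, h10, hb₁⟩ :=
    bump K₁ K₂ hK₁ hK₂ hd (Set.subset_union_left.trans hr)
  obtain ⟨φ₂, hφ₂, hc₂, h21, h20, hb₂⟩ :=
    bump K₂ K₁ hK₂ hK₁ hd.symm (Set.subset_union_right.trans hr)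
  have habs : ∀ x, |φ₁ x - φ₂ x| ≤ 1 := fun x => by
    rw [abs_le]
    constructor <;> linarith [(hb₁ x).1, (hb₁ x).2, (hb₂ x).1, (hb₂ x).2]
  have hle := h (fun x => φ₁ x - φ₂ x) (hφ₁.sub hφ₂) (hc₁.sub hc₂) habs
  have hgφ : Integrable fun x => g x * (φ₁ x - φ₂ x) :=
    hg.mul_bdd (c := 1) (by
      have := hφ₁.continuous
      have := hφ₂.continuous
      fun_prop) (Filter.Eventually.of_forall habs)
  have hm₁ : MeasurableSet ({x | 0 ≤ g x} \ K₁) := hA.diff hK₁.measurableSet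
  have hm₂ : MeasurableSet ({x | 0 ≤ g x}ᶜ \ K₂) := hA.compl.diff hK₂.measurableSet
  have hpt : ∀ x, |g x| ≤ g x * (φ₁ x - φ₂ x) +
      (({x | 0 ≤ g x} \ K₁).indicator (fun x => 2 * |g x|) x +
        ({x | 0 ≤ g x}ᶜ \ K₂).indicator (fun x => 2 * |g x|) x) := by
    intro x
    have hfar : |g x| ≤ g x * (φ₁ x - φ₂ x) + 2 * |g x| := by
      have h3 : |g x * (φ₁ x - φ₂ x)| ≤ |g x| := by
        rw [abs_mul]
        exact mul_le_of_le_one_right (abs_nonneg _) (habs x)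
      linarith [neg_abs_le (g x * (φ₁ x - φ₂ x))]
    by_cases hx : 0 ≤ g x
    · have hx2 : x ∉ {x | 0 ≤ g x}ᶜ \ K₂ := fun h => h.1 hx
      rw [Set.indicator_of_notMem hx2]
      by_cases hxK : x ∈ K₁
      · have hx1 : x ∉ {x | 0 ≤ g x} \ K₁ := fun h => h.2 hxK
        rw [Set.indicator_of_notMem hx1, h11 x hxK, h20 x hxK, abs_of_nonneg hx]
        simp
      · rw [Set.indicator_of_mem (show x ∈ {x | 0 ≤ g x} \ K₁ from ⟨hx, hxK⟩), add_zero]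
        exact hfar
    · have hx2 : x ∉ {x | 0 ≤ g x} \ K₁ := fun h => hx h.1
      rw [Set.indicator_of_notMem hx2]
      by_cases hxK : x ∈ K₂
      · have hx1 : x ∉ {x | 0 ≤ g x}ᶜ \ K₂ := fun h => h.2 hxK
        rw [Set.indicator_of_notMem hx1, h10 x hxK, h21 x hxK, abs_of_neg (not_le.mp hx)]
        simp
      · rw [Set.indicator_of_mem (show x ∈ {x | 0 ≤ g x}ᶜ \ K₂ from ⟨hx, hxK⟩), zero_add]
        exact hfar
  have h2g : Integrable fun x => 2 * |g x| := hg.abs.const_mul 2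
  have hI := integral_mono hg.abs
    (hgφ.add ((h2g.indicator hm₁).add (h2g.indicator hm₂))) hpt
  have e1 : ∫ x, (g x * (φ₁ x - φ₂ x) +
      (({x | 0 ≤ g x} \ K₁).indicator (fun x => 2 * |g x|) x +
        ({x | 0 ≤ g x}ᶜ \ K₂).indicator (fun x => 2 * |g x|) x)) =
      (∫ x, g x * (φ₁ x - φ₂ x)) + (2 * (∫ x in {x | 0 ≤ g x} \ K₁, |g x|) +
        2 * ∫ x in {x | 0 ≤ g x}ᶜ \ K₂, |g x|) := by
    refine (integral_add hgφ ((h2g.indicator hm₁).add (h2g.indicator hm₂))).trans ?_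
    congr 1
    refine (integral_add (h2g.indicator hm₁) (h2g.indicator hm₂)).trans ?_
    rw [integral_indicator hm₁, integral_indicator hm₂, integral_const_mul, integral_const_mul]
  have hI' := hI.trans_eq e1
  linarith

theorem varNorm_nonneg {ρ : ℝ → ℝ} (hρ : BddAbove (varSet ρ)) : 0 ≤ varNorm ρ :=
  le_csSup hρ ⟨0, ⟨contDiff_const, HasCompactSupport.zero, by simp⟩, by simp⟩

theorem integral_abs_sub_translate_le {ρ : ℝ → ℝ} (hρ : Integrable ρ)
    (hbdd : BddAbove (varSet ρ)) (a : ℝ) :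
    ∫ x, |ρ x - ρ (x - a)| ≤ |a| * varNorm ρ := by
  rcases eq_or_ne a 0 with rfl | ha
  · simp
  have ha' : 0 < |a| := abs_pos.mpr ha
  refine integral_abs_le_of_forall_contDiff (hρ.sub (hρ.comp_sub_right a))
    fun φ hφ hc hb => ?_
  simp only [Pi.sub_apply]
  have hφc := hφ.continuous
  have hint : ∀ x y, IntervalIntegrable φ volume x y := fun x y => hφc.intervalIntegrable x y
  set Φ : ℝ → ℝ := fun x => ∫ t in (0 : ℝ)..x, φ t with hΦ
  have hΦd : ∀ x, HasDerivAt Φ (φ x) x := fun x =>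
    intervalIntegral.integral_hasDerivAt_right (hint 0 x)
      (hφc.stronglyMeasurableAtFilter _ _) hφc.continuousAt
  have hΦs : ContDiff ℝ (⊤ : ℕ∞) Φ := by
    rw [contDiff_infty_iff_deriv]
    refine ⟨fun x => (hΦd x).differentiableAt, ?_⟩
    rwa [show deriv Φ = φ from funext fun x => (hΦd x).deriv]
  set v : ℝ → ℝ := fun x => |a|⁻¹ * (Φ x - Φ (x + a)) with hv
  have hw : ∀ x, Φ (x + a) - Φ x = ∫ t in x..(x + a), φ t := fun x =>
    intervalIntegral.integral_interval_sub_left (hint _ _) (hint _ _)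
  have hvd : ∀ x, deriv v x = |a|⁻¹ * (φ x - φ (x + a)) := fun x =>
    (((hΦd x).sub ((hΦd (x + a)).comp_add_const x a)).const_mul _).deriv
  have hmem : ∫ x, ρ x * deriv v x ≤ varNorm ρ := by
    refine le_csSup hbdd ⟨v, ⟨?_, ?_, fun x => ?_⟩, rfl⟩
    · exact contDiff_const.mul (hΦs.sub (hΦs.comp (contDiff_id.add contDiff_const)))
    · obtain ⟨r, hr⟩ := hc.isCompact.isBounded.subset_closedBall 0
      refine HasCompactSupport.intro (isCompact_closedBall (0 : ℝ) (r + |a|)) fun x hx => ?_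
      have : ∫ t in x..(x + a), φ t = 0 := by
        rw [intervalIntegral.integral_congr (g := fun _ => 0) fun t ht => ?_]
        · simp
        · refine image_eq_zero_of_notMem_tsupport fun ht' => hx ?_
          have h1 := hr ht'
          have h2 : |t - x| ≤ |a| := by simpa using Set.abs_sub_left_of_mem_uIcc ht
          rw [mem_closedBall_zero_iff, Real.norm_eq_abs] at h1 ⊢
          have h3 : |x| ≤ |t| + |t - x| := by
            simpa using abs_sub t (t - x)
          linarith
      rw [hv]
      simp only
      rw [← neg_sub, hw, this]
      simp
    · have := intervalIntegral.norm_integral_le_of_norm_le_const (f := φ) (C := 1) (a := x)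
        (b := x + a) fun t _ => hb t
      rw [← hw, Real.norm_eq_abs, add_sub_cancel_left, one_mul, abs_sub_comm] at this
      rw [hv]
      simp only
      rw [abs_mul, abs_inv, abs_abs]
      exact inv_mul_le_one_of_le₀ this ha'.le
  have hbd : ∀ (b : ℝ) , Integrable fun x => ρ x * φ (x + b) := fun b =>
    hρ.mul_bdd (c := 1) (by fun_prop) (Filter.Eventually.of_forall fun x => hb _)
  have hbd0 : Integrable fun x => ρ x * φ x := by simpa using hbd 0
  have e1 : ∫ x, ρ x * deriv v x =
      |a|⁻¹ * ((∫ x, ρ x * φ x) - ∫ x, ρ x * φ (x + a)) := by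
    rw [← integral_sub hbd0 (hbd a), ← integral_const_mul]
    refine integral_congr_ae (Filter.Eventually.of_forall fun x => ?_)
    simp only [hvd]
    ring
  have e2 : ∫ x, ρ x * φ (x + a) = ∫ x, ρ (x - a) * φ x := by
    rw [← integral_sub_right_eq_self (fun x => ρ x * φ (x + a)) a]
    simp
  have e3 : ∫ x, (ρ x - ρ (x - a)) * φ x =
      (∫ x, ρ x * φ x) - ∫ x, ρ (x - a) * φ x := by
    rw [← integral_sub hbd0]
    · simp only [sub_mul]
    · simpa using (hbd a).comp_sub_right a
  rw [e3, ← e2]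
  rw [e1, inv_mul_le_iff₀ ha'] at hmem
  exact hmem

theorem integral_withDensity_le_integral_translate {ρ : ℝ → ℝ} (h0 : ∀ x, 0 ≤ ρ x)
    (hρ : Integrable ρ) (hbdd : BddAbove (varSet ρ)) {h : ℝ → ℝ} (hm : Measurable h) {M : ℝ}
    (hM : ∀ x, |h x| ≤ M) (a : ℝ) :
    ∫ x, h x ∂(volume.withDensity fun x => ENNReal.ofReal (ρ x)) ≤
      (∫ x, h (x + a) ∂(volume.withDensity fun x => ENNReal.ofReal (ρ x))) +
        M * (|a| * varNorm ρ) := by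
  have hM0 : 0 ≤ M := (abs_nonneg _).trans (hM 0)
  have hden : ∀ f : ℝ → ℝ, ∫ x, f x ∂(volume.withDensity fun x => ENNReal.ofReal (ρ x)) =
      ∫ x, ρ x * f x := by
    intro f
    rw [integral_withDensity_eq_integral_toReal_smul₀ hρ.1.aemeasurable.ennreal_ofReal
      (Filter.Eventually.of_forall fun x => ENNReal.ofReal_lt_top)]
    simp [h0]
  have hbd : ∀ (b : ℝ), Integrable fun x => ρ x * h (x + b) := fun b =>
    hρ.mul_bdd (c := M) (hm.comp (measurable_add_const b)).aestronglyMeasurable (Filter.Eventually.of_forall fun x => hM _)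
  have hbd0 : Integrable fun x => ρ x * h x := by simpa using hbd 0
  have hbda : Integrable fun x => ρ (x - a) * h x := by simpa using (hbd a).comp_sub_right a
  have e2 : ∫ x, ρ x * h (x + a) = ∫ x, ρ (x - a) * h x := by
    rw [← integral_sub_right_eq_self (fun x => ρ x * h (x + a)) a]
    simp
  rw [hden, hden, e2, ← sub_le_iff_le_add', ← integral_sub hbd0 hbda]
  calc ∫ x, (ρ x * h x - ρ (x - a) * h x) ≤ ∫ x, M * |ρ x - ρ (x - a)| := by
        refine integral_mono (hbd0.sub hbda) ((hρ.sub (hρ.comp_sub_right a)).abs.const_mul M)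
          fun x => ?_
        simp only
        rw [← sub_mul]
        calc (ρ x - ρ (x - a)) * h x ≤ |ρ x - ρ (x - a)| * |h x| := by
              rw [← abs_mul]; exact le_abs_self _
          _ ≤ |ρ x - ρ (x - a)| * M := mul_le_mul_of_nonneg_left (hM x) (abs_nonneg _)
          _ = _ := mul_comm _ _
    _ = M * ∫ x, |ρ x - ρ (x - a)| := integral_const_mul _ _
    _ ≤ _ := mul_le_mul_of_nonneg_left (integral_abs_sub_translate_le hρ hbdd a) hM0

end TotalVariation

section ProductMeasure

variable {d : ℕ} {P : Measure ((Fin d → ℤ) → ℝ)} {ν : Measure ℝ}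

theorem IsProductOf.eq_infinitePi [IsProbabilityMeasure ν] (hP : IsProductOf P ν) :
    P = Measure.infinitePi fun _ => ν :=
  Measure.eq_infinitePi _ fun s t ht => hP s t fun k _ => ht k

theorem IsProductOf.measurePreserving_update [IsProbabilityMeasure ν] [IsProbabilityMeasure P]
    (hP : IsProductOf P ν) (k : Fin d → ℤ) :
    MeasurePreserving (fun p : ((Fin d → ℤ) → ℝ) × ℝ => Function.update p.1 k p.2)
      (P.prod ν) P := by
  have hmeas : Measurable fun p : ((Fin d → ℤ) → ℝ) × ℝ => Function.update p.1 k p.2 := by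
    refine measurable_pi_lambda _ fun j => ?_
    by_cases hj : j = k
    · subst hj
      simpa using measurable_snd
    · simp only [Function.update_of_ne hj]
      fun_prop
  refine ⟨hmeas, ?_⟩
  conv_rhs => rw [hP.eq_infinitePi]
  refine Measure.eq_infinitePi _ fun s t ht => ?_
  rw [Measure.map_apply hmeas (MeasurableSet.pi s.countable_toSet fun i _ => ht i)]
  have hpre : (fun p : ((Fin d → ℤ) → ℝ) × ℝ => Function.update p.1 k p.2) ⁻¹'
      Set.pi s t = {ω | ∀ j ∈ s.erase k, ω j ∈ t j} ×ˢ (if k ∈ s then t k else Set.univ) := by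
    ext ⟨ω, x⟩
    simp only [Set.mem_preimage, Set.mem_pi, Finset.mem_coe, Set.mem_prod, Finset.mem_erase]
    constructor
    · intro h
      refine ⟨fun j hj => by simpa [hj.1] using h j hj.2, ?_⟩
      split_ifs with hk
      · simpa using h k hk
      · trivial
    · rintro ⟨h1, h2⟩ j hj
      by_cases hjk : j = k
      · subst hjk
        simpa [hj] using h2
      · simpa [hjk] using h1 j ⟨hjk, hj⟩
  rw [hpre, Measure.prod_prod, hP _ _ fun j _ => ht j]
  split_ifs with hk
  · rw [Finset.prod_erase_mul _ _ hk]
  · rw [Finset.erase_eq_of_notMem hk, measure_univ, mul_one]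

variable {ρ : ℝ → ℝ}

theorem IsProductOf.integral_le_integral_add_single [IsProbabilityMeasure ν]
    [IsProbabilityMeasure P] (hP : IsProductOf P ν) (h0 : ∀ x, 0 ≤ ρ x) (hρ : Integrable ρ)
    (hbdd : BddAbove (varSet ρ)) (hν : ν = volume.withDensity fun x => ENNReal.ofReal (ρ x))
    {F : ((Fin d → ℤ) → ℝ) → ℝ} (hF : Measurable F) {M : ℝ} (hM : ∀ ω, |F ω| ≤ M)
    (k : Fin d → ℤ) (a : ℝ) :
    ∫ ω, F ω ∂P ≤ (∫ ω, F (ω + Pi.single k a) ∂P) + M * (|a| * varNorm ρ) := by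
  have hmp := hP.measurePreserving_update k
  have hsplit : ∀ G : ((Fin d → ℤ) → ℝ) → ℝ, Measurable G → (∀ ω, |G ω| ≤ M) →
      ∫ ω, G ω ∂P = ∫ ω, ∫ x, G (Function.update ω k x) ∂ν ∂P ∧
      Integrable (fun ω => ∫ x, G (Function.update ω k x) ∂ν) P := by
    intro G hG hGM
    have hint : Integrable (fun p : ((Fin d → ℤ) → ℝ) × ℝ => G (Function.update p.1 k p.2))
        (P.prod ν) :=
      Integrable.of_bound (hG.comp hmp.measurable).aestronglyMeasurable M
        (Filter.Eventually.of_forall fun p => hGM _)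
    refine ⟨?_, hint.integral_prod_left⟩
    rw [← integral_prod _ hint]
    conv_lhs => rw [← hmp.map_eq]
    exact integral_map hmp.measurable.aemeasurable hG.aestronglyMeasurable
  have hFa : Measurable fun ω : (Fin d → ℤ) → ℝ => F (ω + Pi.single k a) := by fun_prop
  obtain ⟨e1, i1⟩ := hsplit F hF hM
  obtain ⟨e2, i2⟩ := hsplit _ hFa fun ω => hM _
  have e3 : (∫ ω, (∫ x, F (Function.update ω k x + (Pi.single k a : (Fin d → ℤ) → ℝ)) ∂ν) ∂P) +
      M * (|a| * varNorm ρ) =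
      ∫ ω, ((∫ x, F (Function.update ω k x + (Pi.single k a : (Fin d → ℤ) → ℝ)) ∂ν) + M * (|a| * varNorm ρ)) ∂P := by
    rw [integral_add i2 (integrable_const _)]
    simp
  rw [e1, e2, e3]
  refine integral_mono i1 (i2.add (integrable_const _)) fun ω => ?_
  have hupd : ∀ x, Function.update ω k x + (Pi.single k a : (Fin d → ℤ) → ℝ) = Function.update ω k (x + a) := by
    intro x
    ext j
    by_cases hj : j = k
    · subst hj
      simp
    · simp [hj]
  simp only [hupd]
  subst hν
  exact integral_withDensity_le_integral_translate h0 hρ hbdd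
    (hF.comp (measurable_update ω)) (fun x => hM _) a

theorem IsProductOf.integral_le_integral_add_sum_single [IsProbabilityMeasure ν]
    [IsProbabilityMeasure P] (hP : IsProductOf P ν) (h0 : ∀ x, 0 ≤ ρ x) (hρ : Integrable ρ)
    (hbdd : BddAbove (varSet ρ)) (hν : ν = volume.withDensity fun x => ENNReal.ofReal (ρ x))
    {F : ((Fin d → ℤ) → ℝ) → ℝ} (hF : Measurable F) {M : ℝ} (hM : ∀ ω, |F ω| ≤ M)
    (S : Finset (Fin d → ℤ)) (t : (Fin d → ℤ) → ℝ) :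
    ∫ ω, F ω ∂P ≤ (∫ ω, F (ω + ∑ k ∈ S, Pi.single k (t k)) ∂P) +
      M * ((∑ k ∈ S, |t k|) * varNorm ρ) := by
  classical
  induction S using Finset.induction_on with
  | empty => simp
  | insert k S hk ih =>
    have hF' : Measurable fun ω => F (ω + ∑ k ∈ S, Pi.single k (t k)) := by fun_prop
    have := hP.integral_le_integral_add_single h0 hρ hbdd hν hF' (fun ω => hM _) k (t k)
    simp only [Finset.sum_insert hk, ← add_assoc]
    linarith

end ProductMeasure
section GeneratingFunction

variable {d : ℕ}

theorem natCast_dist1 (x y : Fin d → ℤ) : (dist1 x y : ℝ) = ∑ r, |(x r : ℝ) - y r| := by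
  simp [dist1, Nat.cast_natAbs]

theorem natCast_dist1_zero (k : Fin d → ℤ) : (dist1 k 0 : ℝ) = ∑ r, |(k r : ℝ)| := by
  simp [natCast_dist1]

theorem summable_exp_neg_mul_abs_int {γ : ℝ} (hγ : 0 < γ) :
    Summable fun n : ℤ => Real.exp (-(γ * |(n : ℝ)|)) := by
  have h : Summable fun n : ℕ => Real.exp (n * -γ) :=
    Real.summable_exp_nat_mul_iff.mpr (neg_lt_zero.mpr hγ)
  refine Summable.of_nat_of_neg (h.congr fun n => ?_) (h.congr fun n => ?_) <;>
  · simp [mul_comm]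

theorem summable_exp_neg_mul_dist1 {γ : ℝ} (hγ : 0 < γ) :
    Summable fun k : Fin d → ℤ => Real.exp (-(γ * (dist1 k 0 : ℝ))) := by
  classical
  have h1 := summable_exp_neg_mul_abs_int hγ
  refine summable_of_sum_le (c := (∑' n : ℤ, Real.exp (-(γ * |(n : ℝ)|))) ^ d)
    (fun k => (Real.exp_pos _).le) fun S => ?_
  calc ∑ k ∈ S, Real.exp (-(γ * (dist1 k 0 : ℝ)))
      = ∑ k ∈ S, ∏ r, Real.exp (-(γ * |(k r : ℝ)|)) := by
        refine Finset.sum_congr rfl fun k _ => ?_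
        rw [← Real.exp_sum, natCast_dist1_zero, Finset.mul_sum, Finset.sum_neg_distrib]
    _ ≤ ∑ k ∈ Fintype.piFinset fun r => (S.image fun k => k r : Finset ℤ),
          ∏ r, Real.exp (-(γ * |(k r : ℝ)|)) := by
        refine Finset.sum_le_sum_of_subset_of_nonneg (fun k hk => ?_)
          fun k _ _ => Finset.prod_nonneg fun r _ => (Real.exp_pos _).le
        exact Fintype.mem_piFinset.mpr fun r => Finset.mem_image_of_mem _ hk
    _ = ∏ r, ∑ n ∈ (S.image fun k => k r : Finset ℤ), Real.exp (-(γ * |(n : ℝ)|)) :=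
        (Finset.prod_univ_sum (fun r => S.image fun k => k r)
          fun _ (n : ℤ) => Real.exp (-(γ * |(n : ℝ)|))).symm
    _ ≤ ∏ _r : Fin d, ∑' n : ℤ, Real.exp (-(γ * |(n : ℝ)|)) := by
        refine Finset.prod_le_prod (fun r _ => Finset.sum_nonneg fun n _ => (Real.exp_pos _).le)
          fun r _ => h1.sum_le_tsum _ fun n _ => (Real.exp_pos _).le
    _ = _ := by simp

/-- The monomial `k ↦ k^J` on the lattice. -/
def latticeMonomial (J : Fin d → ℕ) (k : Fin d → ℤ) : ℝ := ∏ r, (k r : ℝ) ^ J r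

theorem exists_abs_latticeMonomial_le (J : Fin d → ℕ) {ε : ℝ} (hε : 0 < ε) :
    ∃ K : ℝ, 0 < K ∧ ∀ k : Fin d → ℤ,
      |latticeMonomial J k| ≤ K * Real.exp (ε * (dist1 k 0 : ℝ)) := by
  refine ⟨∏ r, ((J r).factorial / ε ^ J r : ℝ), Finset.prod_pos fun r _ => by positivity,
    fun k => ?_⟩
  rw [latticeMonomial, Finset.abs_prod, natCast_dist1_zero, Finset.mul_sum, Real.exp_sum,
    ← Finset.prod_mul_distrib]
  refine Finset.prod_le_prod (fun r _ => abs_nonneg _) fun r _ => ?_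
  have := Real.pow_div_factorial_le_exp (ε * |(k r : ℝ)|) (by positivity) (J r)
  rw [abs_pow, div_mul_eq_mul_div, le_div_iff₀ (by positivity), mul_comm, ← mul_pow]
  rwa [div_le_iff₀' (by positivity)] at this

theorem sum_mul_le_mul_dist1 (k : Fin d → ℤ) {s : Fin d → ℝ} {β : ℝ} (hs : ∀ r, |s r| ≤ β) :
    ∑ r, (k r : ℝ) * s r ≤ β * (dist1 k 0 : ℝ) := by
  rw [natCast_dist1_zero, Finset.mul_sum]
  refine Finset.sum_le_sum fun r _ => ?_
  calc (k r : ℝ) * s r ≤ |(k r : ℝ)| * |s r| := by rw [← abs_mul]; exact le_abs_self _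
    _ ≤ |(k r : ℝ)| * β := mul_le_mul_of_nonneg_left (hs r) (abs_nonneg _)
    _ = _ := mul_comm _ _

theorem dist1_neg_zero (k : Fin d → ℤ) : dist1 (-k) 0 = dist1 k 0 := by
  simp [dist1]

/-- The series obtained from `Gfun u` by differentiating termwise according to `J`. -/
def momentSeries (u : (Fin d → ℤ) → ℝ) (J : Fin d → ℕ) (s : Fin d → ℝ) : ℝ :=
  ∑' k : Fin d → ℤ, latticeMonomial J k * u (-k) * Real.exp (∑ r, (k r : ℝ) * s r)

variable {u : (Fin d → ℤ) → ℝ} {C α : ℝ}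

theorem exists_summable_bound_momentSeries (hα : 0 < α)
    (hu : ∀ k : Fin d → ℤ, |u k| ≤ C * Real.exp (-(α * (dist1 k 0 : ℝ)))) (J : Fin d → ℕ) :
    ∃ b : (Fin d → ℤ) → ℝ, Summable b ∧ ∀ k (s : Fin d → ℝ), (∀ r, |s r| ≤ α / 2) →
      ‖latticeMonomial J k * u (-k) * Real.exp (∑ r, (k r : ℝ) * s r)‖ ≤ b k := by
  obtain ⟨K, hK, hb⟩ := exists_abs_latticeMonomial_le J (show 0 < α / 4 by linarith)
  refine ⟨fun k => K * C * Real.exp (-(α / 4 * (dist1 k 0 : ℝ))),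
    (summable_exp_neg_mul_dist1 (by linarith)).mul_left _, fun k s hs => ?_⟩
  have h2 := hu (-k)
  rw [dist1_neg_zero] at h2
  rw [Real.norm_eq_abs, abs_mul, abs_mul, Real.abs_exp]
  calc |latticeMonomial J k| * |u (-k)| * Real.exp (∑ r, (k r : ℝ) * s r)
      ≤ (K * Real.exp (α / 4 * (dist1 k 0 : ℝ))) * (C * Real.exp (-(α * (dist1 k 0 : ℝ)))) *
          Real.exp (α / 2 * (dist1 k 0 : ℝ)) := by
        have := Real.exp_le_exp.mpr (sum_mul_le_mul_dist1 k hs)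
        have h3 := hb k
        gcongr
        exact mul_nonneg ((abs_nonneg _).trans h3) ((abs_nonneg _).trans h2)
    _ = K * C * (Real.exp (α / 4 * (dist1 k 0 : ℝ)) * Real.exp (-(α * (dist1 k 0 : ℝ))) *
          Real.exp (α / 2 * (dist1 k 0 : ℝ))) := by ring
    _ = _ := by
        rw [← Real.exp_add, ← Real.exp_add]
        congr 2
        ring

theorem summable_latticeMonomial_mul (hα : 0 < α)
    (hu : ∀ k : Fin d → ℤ, |u k| ≤ C * Real.exp (-(α * (dist1 k 0 : ℝ)))) (J : Fin d → ℕ) :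
    Summable fun k => latticeMonomial J k * u (-k) := by
  obtain ⟨b, hb, hle⟩ := exists_summable_bound_momentSeries hα hu J
  refine Summable.of_norm_bounded hb fun k => ?_
  simpa using hle k 0 fun r => by simp; linarith

theorem latticeMonomial_add_single (J : Fin d → ℕ) (i : Fin d) (k : Fin d → ℤ) :
    latticeMonomial (J + Pi.single i 1) k = latticeMonomial J k * k i := by
  simp only [latticeMonomial, Pi.add_apply, pow_add, Finset.prod_mul_distrib]
  congr 1
  rw [Finset.prod_eq_single i] <;> simp +contextual

theorem hasDerivAt_momentSeries_update (hα : 0 < α)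
    (hu : ∀ k : Fin d → ℤ, |u k| ≤ C * Real.exp (-(α * (dist1 k 0 : ℝ)))) (J : Fin d → ℕ)
    (i : Fin d) {s : Fin d → ℝ} (hs : ∀ r, |s r| < α / 2) :
    HasDerivAt (fun τ => momentSeries u J (Function.update s i τ))
      (momentSeries u (J + Pi.single i 1) s) (s i) := by
  obtain ⟨b, hb, hle⟩ := exists_summable_bound_momentSeries hα hu (J + Pi.single i 1)
  obtain ⟨b', hb', hle'⟩ := exists_summable_bound_momentSeries hα hu J
  have hmem : ∀ τ ∈ Set.Ioo (-(α / 2)) (α / 2), ∀ r, |Function.update s i τ r| ≤ α / 2 := by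
    intro τ hτ r
    by_cases hr : r = i
    · subst hr
      simpa using (abs_lt.mpr hτ).le
    · simpa [hr] using (hs r).le
  have hsi : s i ∈ Set.Ioo (-(α / 2)) (α / 2) := abs_lt.mp (hs i)
  have key := hasDerivAt_tsum_of_isPreconnected (y₀ := s i) (y := s i) hb isOpen_Ioo
    isPreconnected_Ioo
    (g := fun k τ => latticeMonomial J k * u (-k) *
      Real.exp (∑ r, (k r : ℝ) * Function.update s i τ r))
    (g' := fun k τ => latticeMonomial (J + Pi.single i 1) k * u (-k) *
      Real.exp (∑ r, (k r : ℝ) * Function.update s i τ r))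
    (fun k τ _ => ?_) (fun k τ hτ => hle k _ (hmem τ hτ)) hsi
    (Summable.of_norm_bounded hb' fun k => hle' k _ (hmem _ hsi)) hsi
  · simpa [momentSeries] using key
  · have h1 : HasDerivAt (fun τ => ∑ r, (k r : ℝ) * Function.update s i τ r) (k i) τ := by
      have := HasDerivAt.fun_sum (u := Finset.univ) (x := τ)
        (A := fun r τ => (k r : ℝ) * Function.update s i τ r)
        (A' := fun r => (k r : ℝ) * (Pi.single i (1 : ℝ) : Fin d → ℝ) r)
        fun r _ => (hasDerivAt_pi.mp (hasDerivAt_update s i τ) r).const_mul _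
      simpa [Pi.single_apply] using this
    have := h1.exp.const_mul (latticeMonomial J k * u (-k))
    rw [latticeMonomial_add_single]
    exact this.congr_deriv (by ring)

theorem iterPDeriv_eq_momentSeries (hα : 0 < α)
    (hu : ∀ k : Fin d → ℤ, |u k| ≤ C * Real.exp (-(α * (dist1 k 0 : ℝ)))) {J : Fin d → ℕ}
    {f : (Fin d → ℝ) → ℝ} (hf : ∀ s : Fin d → ℝ, (∀ r, |s r| < α / 2) → f s = momentSeries u J s)
    (i : Fin d) (n : ℕ) (s : Fin d → ℝ) (hs : ∀ r, |s r| < α / 2) :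
    iterPDeriv i n f s = momentSeries u (J + Pi.single i n) s := by
  induction n generalizing s with
  | zero => simpa [iterPDeriv] using hf s hs
  | succ n ih =>
    have hev : (fun τ => iterPDeriv i n f (Function.update s i τ)) =ᶠ[nhds (s i)]
        fun τ => momentSeries u (J + Pi.single i n) (Function.update s i τ) := by
      filter_upwards [isOpen_Ioo.mem_nhds (abs_lt.mp (hs i))] with τ hτ
      refine ih _ fun r => ?_
      by_cases hr : r = i
      · subst hr
        simpa using abs_lt.mpr hτ
      · simpa [hr] using hs r
    rw [iterPDeriv, pderiv', hev.deriv_eq, (hasDerivAt_momentSeries_update hα hu _ i hs).deriv,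
      add_assoc, ← Pi.single_add]

theorem mpderiv_Gfun_zero (hα : 0 < α)
    (hu : ∀ k : Fin d → ℤ, |u k| ≤ C * Real.exp (-(α * (dist1 k 0 : ℝ)))) (J : Fin d → ℕ) :
    mpderiv J (Gfun u) 0 = ∑' k, latticeMonomial J k * u (-k) := by
  have key : ∀ (L : List (Fin d)) (s : Fin d → ℝ), (∀ r, |s r| < α / 2) →
      L.foldr (fun i g => iterPDeriv i (J i) g) (Gfun u) s =
        momentSeries u (L.map fun i => Pi.single i (J i)).sum s := by
    intro L
    induction L with
    | nil =>
      intro s _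
      simp [Gfun, momentSeries, latticeMonomial]
    | cons i L ih =>
      intro s hs
      rw [List.foldr_cons, iterPDeriv_eq_momentSeries hα hu ih i (J i) s hs, List.map_cons,
        List.sum_cons, add_comm]
  have hsum : ((List.finRange d).map fun i => (Pi.single i (J i) : Fin d → ℕ)).sum = J := by
    rw [← List.ofFn_eq_map, List.sum_ofFn, Finset.univ_sum_single]
  rw [mpderiv, key _ _ fun r => by simpa using hα, hsum]
  simp [momentSeries]

theorem latticeMonomial_add (I : Fin d → ℕ) (x m : Fin d → ℤ) :
    latticeMonomial I (x + m) = ∑ J ∈ Fintype.piFinset fun r => Finset.range (I r + 1),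
      (∏ r, (x r : ℝ) ^ (I r - J r) * ((I r).choose (J r) : ℝ)) * latticeMonomial J m := by
  simp only [latticeMonomial, ← Finset.prod_mul_distrib]
  rw [← Finset.prod_univ_sum (fun r => Finset.range (I r + 1))
    fun r j => (x r : ℝ) ^ (I r - j) * ((I r).choose j : ℝ) * (m r : ℝ) ^ j]
  refine Finset.prod_congr rfl fun r _ => ?_
  rw [Pi.add_apply, Int.cast_add, add_comm, add_pow]
  exact Finset.sum_congr rfl fun j _ => by ring

theorem summable_latticeMonomial_mul_sub (hα : 0 < α)
    (hu : ∀ k : Fin d → ℤ, |u k| ≤ C * Real.exp (-(α * (dist1 k 0 : ℝ)))) (I : Fin d → ℕ)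
    (x : Fin d → ℤ) : Summable fun k => latticeMonomial I k * u (x - k) := by
  rw [← (Equiv.addLeft x).summable_iff]
  simp only [Function.comp_def, Equiv.coe_addLeft, latticeMonomial_add, Finset.sum_mul,
    sub_add_cancel_left, mul_assoc]
  exact summable_sum fun J _ => (summable_latticeMonomial_mul hα hu J).mul_left _

theorem tsum_latticeMonomial_mul_sub (hα : 0 < α)
    (hu : ∀ k : Fin d → ℤ, |u k| ≤ C * Real.exp (-(α * (dist1 k 0 : ℝ)))) {I : Fin d → ℕ} {c : ℝ}
    (h1 : ∀ J : Fin d → ℕ, (∀ r, J r ≤ I r) → J ≠ I → mpderiv J (Gfun u) (0 : Fin d → ℝ) = 0)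
    (h2 : mpderiv I (Gfun u) (0 : Fin d → ℝ) = c) (x : Fin d → ℤ) :
    ∑' k, latticeMonomial I k * u (x - k) = c := by
  rw [← (Equiv.addLeft x).tsum_eq]
  simp only [Equiv.coe_addLeft, latticeMonomial_add, Finset.sum_mul, sub_add_cancel_left, mul_assoc]
  rw [Summable.tsum_finsetSum fun J _ => (summable_latticeMonomial_mul hα hu J).mul_left _]
  simp only [tsum_mul_left, ← mpderiv_Gfun_zero hα hu]
  rw [Finset.sum_eq_single I, h2]
  · simp
  · intro J hJ hne
    rw [h1 J (fun r => Nat.lt_succ_iff.mp (Finset.mem_range.mp (Fintype.mem_piFinset.mp hJ r))) hne,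
      mul_zero]
  · intro h
    exact absurd (Fintype.mem_piFinset.mpr fun r => by simp) h

theorem mem_cube_zero {l : ℕ} {x : Fin d → ℤ} : x ∈ cube l 0 ↔ ∀ r, |(x r : ℝ)| ≤ l := by
  simp only [cube, Fintype.mem_piFinset, Finset.mem_Icc, Pi.zero_apply, zero_sub, zero_add, abs_le]
  refine forall_congr' fun r => ?_
  norm_cast

theorem card_cube_zero (l : ℕ) : (cube l (0 : Fin d → ℤ)).card = (2 * l + 1) ^ d := by
  simp [cube]
  congr 1
  omega

theorem exists_linear_radius_of_tsum_eq (hα : 0 < α) (hC : 0 < C)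
    (hu : ∀ k : Fin d → ℤ, |u k| ≤ C * Real.exp (-(α * (dist1 k 0 : ℝ)))) {I : Fin d → ℕ} {c : ℝ}
    (h : ∀ x, ∑' k, latticeMonomial I k * u (x - k) = c) {δ : ℝ} (hδ : 0 < δ) :
    ∃ D : ℕ, 0 < D ∧ ∀ l : ℕ, ∃ R : ℕ, R ≤ D * (2 * l + 1) ∧ ∀ x ∈ cube l (0 : Fin d → ℤ),
      |c - ∑ k ∈ cube R 0, latticeMonomial I k * u (x - k)| ≤ δ := by
  obtain ⟨K, hK, hb⟩ := exists_abs_latticeMonomial_le I (show 0 < α / 2 by linarith)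
  have hsum := summable_exp_neg_mul_dist1 (d := d) (show 0 < α / 4 by linarith)
  set S := ∑' k : Fin d → ℤ, Real.exp (-(α / 4 * (dist1 k 0 : ℝ))) with hS
  have hS0 : 0 ≤ S := tsum_nonneg fun k => (Real.exp_pos _).le
  obtain ⟨R₀, hR₀⟩ : ∃ R₀ : ℕ, K * C * S * Real.exp (-(α / 4 * R₀)) ≤ δ := by
    have h1 : Filter.Tendsto (fun n : ℕ => K * C * S * Real.exp (-(α / 4 * n))) Filter.atTop
        (nhds (K * C * S * 0)) := by
      refine Filter.Tendsto.const_mul _ (Real.tendsto_exp_neg_atTop_nhds_zero.comp ?_)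
      exact tendsto_natCast_atTop_atTop.const_mul_atTop (by linarith)
    rw [mul_zero] at h1
    exact (h1.eventually (eventually_le_nhds hδ)).exists
  refine ⟨4 * d + R₀ + 1, by omega, fun l => ⟨4 * d * l + R₀, by nlinarith, fun x hx => ?_⟩⟩
  set R := 4 * d * l + R₀ with hR
  have hxs := summable_latticeMonomial_mul_sub hα hu I x
  rw [← h x, ← hxs.sum_add_tsum_compl (s := cube R 0), add_sub_cancel_left]
  have hx1 : (dist1 x 0 : ℝ) ≤ d * l := by
    rw [natCast_dist1_zero]
    calc ∑ r, |(x r : ℝ)| ≤ ∑ _r : Fin d, (l : ℝ) :=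
          Finset.sum_le_sum fun r _ => mem_cube_zero.mp hx r
      _ = _ := by simp
  have hbound : ∀ k : ((cube R (0 : Fin d → ℤ) : Set (Fin d → ℤ))ᶜ : Set _),
      ‖latticeMonomial I k * u (x - k)‖ ≤ K * C * Real.exp (-(α / 4 * R₀)) *
        Real.exp (-(α / 4 * (dist1 (k : Fin d → ℤ) 0 : ℝ))) := by
    rintro ⟨k, hk⟩
    have hkR : (R : ℝ) ≤ dist1 k 0 := by
      have : ¬ ∀ r, |(k r : ℝ)| ≤ R := fun h => hk (mem_cube_zero.mpr h)
      push Not at this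
      obtain ⟨r, hr⟩ := this
      rw [natCast_dist1_zero]
      exact hr.le.trans (Finset.single_le_sum (f := fun r => |(k r : ℝ)|)
        (fun r _ => abs_nonneg _) (Finset.mem_univ r))
    have htri : (dist1 k 0 : ℝ) ≤ dist1 (x - k) 0 + dist1 x 0 := by
      simp only [natCast_dist1_zero, ← Finset.sum_add_distrib]
      refine Finset.sum_le_sum fun r _ => ?_
      have := abs_sub (x r : ℝ) ((x r : ℝ) - k r)
      simp only [sub_sub_cancel] at this
      push_cast [Pi.sub_apply]
      linarith
    have hRc : (R : ℝ) = 4 * d * l + R₀ := by simp [hR]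
    rw [Real.norm_eq_abs, abs_mul]
    calc |latticeMonomial I k| * |u (x - k)|
        ≤ (K * Real.exp (α / 2 * (dist1 k 0 : ℝ))) *
            (C * Real.exp (-(α * (dist1 (x - k) 0 : ℝ)))) := by
          have h1 := hb k
          have h2 := hu (x - k)
          gcongr
      _ = K * C * (Real.exp (α / 2 * (dist1 k 0 : ℝ)) *
            Real.exp (-(α * (dist1 (x - k) 0 : ℝ)))) := by ring
      _ ≤ K * C * (Real.exp (-(α / 4 * R₀)) * Real.exp (-(α / 4 * (dist1 k 0 : ℝ)))) := by
          rw [← Real.exp_add, ← Real.exp_add]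
          refine mul_le_mul_of_nonneg_left (Real.exp_le_exp.mpr ?_) (by positivity)
          have h1 := mul_le_mul_of_nonneg_left (htri.trans (add_le_add_right hx1 _)) hα.le
          have h2 := mul_le_mul_of_nonneg_left (hRc ▸ hkR) hα.le
          linarith
      _ = _ := by ring
  have hsub := hsum.subtype ((cube R (0 : Fin d → ℤ) : Set (Fin d → ℤ))ᶜ)
  have hsub' := hsub.mul_left (K * C * Real.exp (-(α / 4 * R₀)))
  refine (tsum_of_norm_bounded hsub'.hasSum hbound).trans ?_
  have hle : ∑' k : ((cube R (0 : Fin d → ℤ) : Set (Fin d → ℤ))ᶜ : Set _),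
      Real.exp (-(α / 4 * (dist1 (k : Fin d → ℤ) 0 : ℝ))) ≤ S :=
    hsum.tsum_subtype_le _ _ fun k => (Real.exp_pos _).le
  simp only [Function.comp_apply] at *
  rw [tsum_mul_left]
  calc _ ≤ K * C * Real.exp (-(α / 4 * R₀)) * S :=
        mul_le_mul_of_nonneg_left hle (by positivity)
    _ = K * C * S * Real.exp (-(α / 4 * R₀)) := by ring
    _ ≤ δ := hR₀

theorem sum_abs_latticeMonomial_le (I : Fin d → ℕ) {R D L : ℕ} (hD : 0 < D) (hL : 0 < L)
    (h : R ≤ D * L) :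
    ∑ k ∈ cube R 0, |latticeMonomial I k| ≤
      ((2 * D + 1) ^ d * D ^ ∑ r, I r : ℝ) * (L : ℝ) ^ (d + ∑ r, I r) := by
  have hRD : (R : ℝ) ≤ D * L := by exact_mod_cast h
  calc ∑ k ∈ cube R 0, |latticeMonomial I k|
      ≤ ∑ _k ∈ cube R (0 : Fin d → ℤ), (R : ℝ) ^ ∑ r, I r := by
        refine Finset.sum_le_sum fun k hk => ?_
        rw [latticeMonomial, Finset.abs_prod, ← Finset.prod_pow_eq_pow_sum]
        refine Finset.prod_le_prod (fun r _ => abs_nonneg _) fun r _ => ?_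
        rw [abs_pow]
        exact pow_le_pow_left₀ (abs_nonneg _) (mem_cube_zero.mp hk r) _
    _ = (2 * R + 1 : ℝ) ^ d * (R : ℝ) ^ ∑ r, I r := by
        rw [Finset.sum_const, card_cube_zero, nsmul_eq_mul]
        push_cast
        rfl
    _ ≤ ((2 * D + 1) * L : ℝ) ^ d * (D * L : ℝ) ^ ∑ r, I r := by
        have hL1 : (1 : ℝ) ≤ L := by exact_mod_cast hL
        gcongr
        linarith
    _ = _ := by rw [mul_pow, mul_pow, pow_add]; ring

end GeneratingFunction
section Potential

open scoped Matrix

variable {d : ℕ}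

theorem measurable_potential (u : (Fin d → ℤ) → ℝ) (x : Fin d → ℤ) :
    Measurable fun ω => potential u ω x :=
  Measurable.tsum fun k => (measurable_pi_apply k).mul_const _

theorem dist1_comm (x y : Fin d → ℤ) : dist1 x y = dist1 y x :=
  Finset.sum_congr rfl fun i _ => by omega

theorem isHermitian_hamiltonian (lam : ℝ) (u ω : (Fin d → ℤ) → ℝ) (Λ : Finset (Fin d → ℤ)) :
    (hamiltonian lam u ω Λ).IsHermitian := by
  ext x y
  rw [Matrix.conjTranspose_apply, star_trivial]
  simp only [hamiltonian, Matrix.of_apply]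
  rw [dist1_comm]
  by_cases hxy : x = y
  · subst hxy
    rfl
  · simp [hxy, Ne.symm hxy]

theorem measurable_hamiltonian_apply (lam : ℝ) (u : (Fin d → ℤ) → ℝ) (Λ : Finset (Fin d → ℤ))
    (x y : Λ) : Measurable fun ω => hamiltonian lam u ω Λ x y := by
  simp only [hamiltonian, Matrix.of_apply]
  split_ifs
  · exact measurable_const
  · exact (measurable_potential u _).const_mul _
  · exact measurable_const

theorem hamiltonian_eq_add_diagonal (lam : ℝ) (u ω ω' : (Fin d → ℤ) → ℝ)
    (Λ : Finset (Fin d → ℤ)) :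
    hamiltonian lam u ω' Λ = hamiltonian lam u ω Λ +
      Matrix.diagonal fun x : Λ => lam * (potential u ω' x - potential u ω x) := by
  ext x y
  simp only [hamiltonian, Matrix.of_apply, Matrix.add_apply]
  by_cases hxy : x = y
  · subst hxy
    simp [dist1]
    ring
  · simp [hxy]

theorem eigCount_hamiltonian_le {lam : ℝ} {u ω ω' : (Fin d → ℤ) → ℝ}
    {Λ : Finset (Fin d → ℤ)} {E F : ℝ}
    (h : ∀ x ∈ Λ, F - E ≤ lam * (potential u ω' x - potential u ω x)) :
    eigCount (hamiltonian lam u ω' Λ) (Set.Iio F) ≤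
      eigCount (hamiltonian lam u ω Λ) (Set.Iio E) := by
  refine eigCount_Iio_le_of_form_le (isHermitian_hamiltonian _ _ _ _)
    (isHermitian_hamiltonian _ _ _ _) fun y => ?_
  rw [hamiltonian_eq_add_diagonal lam u ω ω', Matrix.add_mulVec, dotProduct_add]
  refine add_le_add_right ?_ _
  simp only [dotProduct, Matrix.mulVec_diagonal, Finset.mul_sum]
  refine Finset.sum_le_sum fun x _ => ?_
  have := mul_le_mul_of_nonneg_right (h x x.2) (mul_self_nonneg (y x))
  linarith

theorem summable_mul_of_bounded {u ω : (Fin d → ℤ) → ℝ} {C α R : ℝ} (hα : 0 < α)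
    (hu : ∀ k : Fin d → ℤ, |u k| ≤ C * Real.exp (-(α * (dist1 k 0 : ℝ))))
    (hω : ∀ k, |ω k| ≤ R) (x : Fin d → ℤ) : Summable fun k => ω k * u (x - k) := by
  have h1 : Summable fun k => |u k| :=
    Summable.of_nonneg_of_le (fun _ => abs_nonneg _) hu ((summable_exp_neg_mul_dist1 hα).mul_left C)
  have h2 : Summable fun k => |u (x - k)| := (Equiv.subLeft x).summable_iff.mpr h1
  refine Summable.of_norm_bounded (h2.mul_left R) fun k => ?_
  rw [Real.norm_eq_abs, abs_mul]
  exact mul_le_mul_of_nonneg_right (hω k) (abs_nonneg _)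

theorem potential_add_sum_single {u ω : (Fin d → ℤ) → ℝ} {x : Fin d → ℤ}
    (h : Summable fun k => ω k * u (x - k)) (S : Finset (Fin d → ℤ)) (t : (Fin d → ℤ) → ℝ) :
    potential u (ω + ∑ k ∈ S, Pi.single k (t k)) x =
      potential u ω x + ∑ k ∈ S, t k * u (x - k) := by
  have hval : ∀ k, (∑ j ∈ S, (Pi.single j (t j) : (Fin d → ℤ) → ℝ)) k =
      if k ∈ S then t k else 0 := by
    intro k
    simp [Finset.sum_apply, Pi.single_apply]
  have hfin : ∀ k ∉ S, (if k ∈ S then t k else 0) * u (x - k) = 0 := fun k hk => by simp [hk]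
  simp only [potential, Pi.add_apply, hval, add_mul]
  rw [h.tsum_add (summable_of_ne_finset_zero hfin), tsum_eq_sum hfin]
  congr 1
  exact Finset.sum_congr rfl fun k hk => by simp [hk]

theorem IsProductOf.ae_forall_abs_le {P : Measure ((Fin d → ℤ) → ℝ)} {ν : Measure ℝ}
    [IsProbabilityMeasure P] (hP : IsProductOf P ν) {R : ℝ} (hR : ν (Set.Icc (-R) R) = 1) :
    ∀ᵐ ω ∂P, ∀ k, |ω k| ≤ R := by
  refine ae_all_iff.mpr fun k => ?_
  have h1 := hP {k} (fun _ => Set.Icc (-R) R) fun _ _ => measurableSet_Icc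
  rw [Finset.prod_singleton, hR] at h1
  have hm : MeasurableSet {ω : (Fin d → ℤ) → ℝ | ∀ j ∈ ({k} : Finset (Fin d → ℤ)),
      ω j ∈ Set.Icc (-R) R} := by
    simp only [Finset.mem_singleton, forall_eq]
    exact measurable_pi_apply k measurableSet_Icc
  have h2 := (mem_ae_iff_prob_eq_one hm).mpr h1
  filter_upwards [h2] with ω hω
  exact abs_le.mpr (hω k (Finset.mem_singleton_self k))

/-- If shifting the couplings in the finite set `S` along `t` raises the potential by at least
`1` on `Λ`, then the expected number of eigenvalues in an interval is controlled by the length of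
the interval and the `ℓ¹` norm of `t`. -/
theorem lintegral_eigCount_le_of_shift {u : (Fin d → ℤ) → ℝ} {C α : ℝ} (hα : 0 < α)
    (hu : ∀ k : Fin d → ℤ, |u k| ≤ C * Real.exp (-(α * (dist1 k 0 : ℝ))))
    {Λ S : Finset (Fin d → ℤ)} {t : (Fin d → ℤ) → ℝ}
    (ht : ∀ x ∈ Λ, 1 ≤ ∑ k ∈ S, t k * u (x - k))
    {lam : ℝ} (hlam : 0 < lam) {ρ : ℝ → ℝ} (h0 : ∀ x, 0 ≤ ρ x) (hρ : Integrable ρ)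
    (hbdd : BddAbove (varSet ρ)) {ν : Measure ℝ}
    (hν : ν = volume.withDensity fun x => ENNReal.ofReal (ρ x)) [IsProbabilityMeasure ν]
    {R : ℝ} (hR : ν (Set.Icc (-R) R) = 1) {P : Measure ((Fin d → ℤ) → ℝ)}
    [IsProbabilityMeasure P] (hP : IsProductOf P ν) {E₁ E₂ : ℝ} (hE : E₁ ≤ E₂) :
    ∫⁻ ω, (eigCount (hamiltonian lam u ω Λ) (Set.Icc E₁ E₂) : ℝ≥0∞) ∂P ≤
      ENNReal.ofReal (lam⁻¹ * (E₂ - E₁) * Λ.card * (∑ k ∈ S, |t k|) * varNorm ρ) := by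
  have key : ∀ G, E₂ < G →
      ∫⁻ ω, (eigCount (hamiltonian lam u ω Λ) (Set.Icc E₁ E₂) : ℝ≥0∞) ∂P ≤
        ENNReal.ofReal (lam⁻¹ * (G - E₁) * Λ.card * (∑ k ∈ S, |t k|) * varNorm ρ) := by
    intro G hG
    set s : ℝ := lam⁻¹ * (G - E₁) with hs
    have hs0 : 0 ≤ s := mul_nonneg (inv_nonneg.mpr hlam.le) (by linarith)
    set F : ((Fin d → ℤ) → ℝ) → ℝ := fun ω =>
      (eigCount (hamiltonian lam u ω Λ) (Set.Iio G) : ℝ) with hF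
    have hFm : Measurable F := measurable_from_top.comp
      (measurable_eigCount_Iio (fun ω => isHermitian_hamiltonian lam u ω Λ)
        (measurable_hamiltonian_apply lam u Λ) G)
    have hFb : ∀ ω, |F ω| ≤ Λ.card := fun ω => by
      rw [hF, Nat.abs_cast]
      exact_mod_cast (eigCount_le_card _ _).trans_eq (Fintype.card_coe Λ)
    set τ : (Fin d → ℤ) → ℝ := ∑ k ∈ S, Pi.single k (s * t k) with hτ
    have hFτm : Measurable fun ω => F (ω + τ) := hFm.comp (measurable_add_const τ)
    have hshift := hP.integral_le_integral_add_sum_single h0 hρ hbdd hν hFm hFb S fun k => s * t k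
    have hae : ∀ᵐ ω ∂P, (eigCount (hamiltonian lam u ω Λ) (Set.Icc E₁ E₂) : ℝ) ≤
        F ω - F (ω + τ) := by
      filter_upwards [hP.ae_forall_abs_le hR] with ω hω
      have h1 := eigCount_Icc_add_Iio_le (hamiltonian lam u ω Λ) hE hG
      have h2 : eigCount (hamiltonian lam u (ω + τ) Λ) (Set.Iio G) ≤
          eigCount (hamiltonian lam u ω Λ) (Set.Iio E₁) := by
        refine eigCount_hamiltonian_le fun x hx => ?_
        rw [hτ, potential_add_sum_single (summable_mul_of_bounded hα hu hω x), add_sub_cancel_left]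
        simp only [mul_assoc]
        rw [← Finset.mul_sum]
        calc G - E₁ = lam * s * 1 := by rw [hs]; field_simp
          _ ≤ lam * s * ∑ k ∈ S, t k * u (x - k) :=
            mul_le_mul_of_nonneg_left (ht x hx) (mul_nonneg hlam.le hs0)
          _ = _ := by ring
      have h3 := (Nat.add_le_add_left h2 _).trans h1
      have h4 : (eigCount (hamiltonian lam u ω Λ) (Set.Icc E₁ E₂) : ℝ) + F (ω + τ) ≤ F ω := by
        simp only [hF]
        exact_mod_cast h3
      linarith
    have i1 : Integrable F P := Integrable.of_bound hFm.aestronglyMeasurable _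
      (Filter.Eventually.of_forall hFb)
    have i2 : Integrable (fun ω => F (ω + τ)) P := Integrable.of_bound hFτm.aestronglyMeasurable _
      (Filter.Eventually.of_forall fun ω => hFb _)
    calc ∫⁻ ω, (eigCount (hamiltonian lam u ω Λ) (Set.Icc E₁ E₂) : ℝ≥0∞) ∂P
        ≤ ∫⁻ ω, ENNReal.ofReal (F ω - F (ω + τ)) ∂P := by
          refine lintegral_mono_ae (hae.mono fun ω hω => ?_)
          rw [← ENNReal.ofReal_natCast]
          exact ENNReal.ofReal_le_ofReal hω
      _ = ENNReal.ofReal (∫ ω, (F ω - F (ω + τ)) ∂P) :=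
          (ofReal_integral_eq_lintegral_ofReal (i1.sub i2)
            (hae.mono fun ω hω => (Nat.cast_nonneg _).trans hω)).symm
      _ ≤ _ := by
          refine ENNReal.ofReal_le_ofReal ?_
          rw [integral_sub i1 i2, sub_le_iff_le_add']
          refine hshift.trans_eq ?_
          simp only [abs_mul, abs_of_nonneg hs0, ← Finset.mul_sum]
          ring
  refine ge_of_tendsto (x := nhdsWithin E₂ (Set.Ioi E₂)) (f := fun G => ENNReal.ofReal
    (lam⁻¹ * (G - E₁) * Λ.card * (∑ k ∈ S, |t k|) * varNorm ρ)) ?_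
    (Filter.eventually_of_mem self_mem_nhdsWithin fun G hG => key G hG)
  have hcont : Continuous fun G => ENNReal.ofReal
    (lam⁻¹ * (G - E₁) * Λ.card * (∑ k ∈ S, |t k|) * varNorm ρ) :=
    ENNReal.continuous_ofReal.comp (by fun_prop)
  exact hcont.continuousAt.mono_left nhdsWithin_le_nhds

end Potential

/-- **Wegner estimate for exponentially decaying sign-indefinite single-site potentials**
(Theorem 2.6). -/
theorem stmt_10 (d : ℕ) (hd : 1 ≤ d) (u : (Fin d → ℤ) → ℝ)
    (Cdec α : ℝ) (hCdec : 0 < Cdec) (hα : 0 < α)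
    (hu_decay : ∀ k : Fin d → ℤ, |u k| ≤ Cdec * Real.exp (-(α * (dist1 k 0 : ℝ))))
    (I₀ : Fin d → ℕ) (cu : ℝ) (hcu : cu ≠ 0)
    (hD1 : ∀ J : Fin d → ℕ, (∀ r, J r ≤ I₀ r) → J ≠ I₀ →
      mpderiv J (Gfun u) (0 : Fin d → ℝ) = 0)
    (hD2 : mpderiv I₀ (Gfun u) (0 : Fin d → ℝ) = cu) :
    ∃ Cu : ℝ, 0 < Cu ∧
      ∀ lam : ℝ, 0 < lam →
      ∀ ρ : ℝ → ℝ, (∀ x, 0 ≤ ρ x) → Integrable ρ → BddAbove (varSet ρ) →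
      ∀ ν : Measure ℝ, ν = volume.withDensity (fun x => ENNReal.ofReal (ρ x)) →
        IsProbabilityMeasure ν → (∃ R : ℝ, 0 < R ∧ ν (Set.Icc (-R) R) = 1) →
      ∀ P : Measure ((Fin d → ℤ) → ℝ), IsProbabilityMeasure P → IsProductOf P ν →
      ∀ l : ℕ, 1 ≤ l → ∀ E1 E2 : ℝ, E1 ≤ E2 →
        ∫⁻ ω, (eigCount (hamiltonian lam u ω (cube l 0)) (Set.Icc E1 E2) : ℝ≥0∞) ∂P
          ≤ ENNReal.ofReal (lam⁻¹ * Cu * varNorm ρ * (E2 - E1) *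
              (2 * (l : ℝ) + 1) ^ (2 * d + ∑ r, I₀ r)) := by
  set δ : ℝ := |cu| / 2 with hδ
  have hδ0 : 0 < δ := half_pos (abs_pos.mpr hcu)
  obtain ⟨D, hD, hrad⟩ := exists_linear_radius_of_tsum_eq hα hCdec hu_decay
    (tsum_latticeMonomial_mul_sub hα hu_decay hD1 hD2) hδ0
  refine ⟨δ⁻¹ * ((2 * D + 1) ^ d * D ^ ∑ r, I₀ r), by positivity, ?_⟩
  rintro lam hlam ρ h0 hρ hbdd ν hν hνp ⟨R, -, hR⟩ P hPp hP l - E1 E2 hE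
  obtain ⟨r, hr, hle⟩ := hrad l
  have ht : ∀ x ∈ cube l (0 : Fin d → ℤ), 1 ≤ ∑ k ∈ cube r (0 : Fin d → ℤ),
      (δ⁻¹ * (SignType.sign cu : ℝ) * latticeMonomial I₀ k) * u (x - k) := by
    intro x hx
    have h1 := hle x hx
    simp only [mul_assoc, ← Finset.mul_sum]
    rw [le_inv_mul_iff₀ hδ0, mul_one]
    rcases hcu.lt_or_gt with hneg | hpos
    · rw [abs_of_neg hneg] at hδ
      simp only [sign_neg hneg, SignType.coe_neg_one]
      linarith [(abs_le.mp h1).1]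
    · rw [abs_of_pos hpos] at hδ
      simp only [sign_pos hpos, SignType.coe_one]
      linarith [(abs_le.mp h1).2]
  refine (lintegral_eigCount_le_of_shift hα hu_decay ht hlam h0 hρ hbdd hν hR hP hE).trans
    (ENNReal.ofReal_le_ofReal ?_)
  have hsum : ∑ k ∈ cube r (0 : Fin d → ℤ),
      |δ⁻¹ * (SignType.sign cu : ℝ) * latticeMonomial I₀ k| ≤
      δ⁻¹ * (((2 * D + 1) ^ d * D ^ ∑ r, I₀ r : ℝ) * (2 * (l : ℝ) + 1) ^ (d + ∑ r, I₀ r)) := by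
    have hsgn : |(SignType.sign cu : ℝ)| = 1 := by
      rcases hcu.lt_or_gt with hneg | hpos
      · simp [sign_neg hneg]
      · simp [sign_pos hpos]
    simp only [abs_mul, hsgn, mul_one, ← Finset.mul_sum, abs_inv, abs_of_pos hδ0]
    have := sum_abs_latticeMonomial_le I₀ hD (Nat.succ_pos (2 * l)) hr
    push_cast at this
    exact mul_le_mul_of_nonneg_left this (inv_nonneg.mpr hδ0.le)
  have hv := varNorm_nonneg hbdd
  have hE' : 0 ≤ E2 - E1 := sub_nonneg.mpr hE
  rw [card_cube_zero]
  push_cast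
  calc _ ≤ lam⁻¹ * (E2 - E1) * (2 * (l : ℝ) + 1) ^ d *
        (δ⁻¹ * (((2 * D + 1) ^ d * D ^ ∑ r, I₀ r : ℝ) *
          (2 * (l : ℝ) + 1) ^ (d + ∑ r, I₀ r))) * varNorm ρ := by gcongr
    _ = _ := by ring

end
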